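/- arXiv:2503.14116 — 3 statements merged into one kernel-verified Lean document; each statement's English description precedes it below -/
import Mathlib

section
/- Let A_ρ ⊆ M_n(ℂ) be a structural matrix algebra and let F ⊆ A_ρ be a commuting family of diagonalizable matrices. Then there exists an invertible matrix S ∈ A_ρ (with S⁻¹ ∈ A_ρ) such that S X S⁻¹ is a diagonal matrix for every X ∈ F. -/
/-- The structural matrix algebra determined by a quasi-order `ρ` on `Fin n`:
all complex `n × n` matrices supported in `ρ`. -/
def structuralMatrixAlgebra {n : ℕ} (ρ : Fin n → Fin n → Prop) :
    Set (Matrix (Fin n) (Fin n) ℂ) :=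
  {X | ∀ i j, ¬ ρ i j → X i j = 0}

open Matrix in
/-- A generalized eigenvector of a diagonalizable matrix is an eigenvector. -/
lemma diagonalizable_gen_eigen {n : ℕ} (X P : Matrix (Fin n) (Fin n) ℂ) (hP : IsUnit P)
    (hD : (P * X * P⁻¹).IsDiag) (μ : ℂ) (k : ℕ) (v : Fin n → ℂ)
    (h : ((X - μ • (1 : Matrix (Fin n) (Fin n) ℂ)) ^ k) *ᵥ v = 0) : X *ᵥ v = μ • v := by
  have hdet : IsUnit P.det := (Matrix.isUnit_iff_isUnit_det P).1 hP
  obtain ⟨d, hd⟩ : ∃ d : Fin n → ℂ, P * X * P⁻¹ = diagonal d :=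
    ⟨_, hD.diagonal_diag.symm⟩
  have hPX : P * X = diagonal d * P := by
    rw [← hd, Matrix.mul_assoc, Matrix.nonsing_inv_mul P hdet, Matrix.mul_one]
  have h1 : P * (X - μ • (1 : Matrix (Fin n) (Fin n) ℂ)) = diagonal (fun i => d i - μ) * P := by
    rw [Matrix.mul_sub, hPX, show diagonal (fun i => d i - μ)
      = diagonal d - μ • (1 : Matrix (Fin n) (Fin n) ℂ) from ?_, Matrix.sub_mul]
    · simp
    · ext i j
      by_cases hij : i = j
      · subst hij; simp
      · simp [hij]
  have hk : ∀ k : ℕ, P * (X - μ • (1 : Matrix (Fin n) (Fin n) ℂ)) ^ k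
      = diagonal (fun i => (d i - μ) ^ k) * P := by
    intro k
    induction k with
    | zero => simp
    | succ k ih =>
      rw [pow_succ, ← Matrix.mul_assoc, ih, Matrix.mul_assoc, h1, ← Matrix.mul_assoc,
        diagonal_mul_diagonal]
      simp [pow_succ]
  have h2 : ∀ i, (d i - μ) ^ k * (P *ᵥ v) i = 0 := by
    intro i
    have h3 : (P * (X - μ • (1 : Matrix (Fin n) (Fin n) ℂ)) ^ k) *ᵥ v = 0 := by
      rw [← mulVec_mulVec, h, mulVec_zero]
    rw [hk, ← mulVec_mulVec] at h3
    have := congrFun h3 i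
    rwa [mulVec_diagonal] at this
  have h4 : P *ᵥ (X *ᵥ v) = P *ᵥ (μ • v) := by
    rw [mulVec_mulVec, hPX, ← mulVec_mulVec, mulVec_smul]
    ext i
    rw [mulVec_diagonal]
    rcases mul_eq_zero.1 (h2 i) with h5 | h5
    · rw [sub_eq_zero.1 (eq_zero_of_pow_eq_zero h5)]; rfl
    · simp [h5]
  have := congrArg (fun w => P⁻¹ *ᵥ w) h4
  simpa [mulVec_mulVec, ← Matrix.mul_assoc, Matrix.nonsing_inv_mul P hdet] using this

/-- If each standard basis vector lies in the span of `C j`, one can pick a vector in each `C j`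
so that the chosen vectors form an invertible matrix. -/
lemma exists_choice_det_ne_zero {n : ℕ} (C : Fin n → Set (Fin n → ℂ))
    (hC : ∀ j, (Pi.single j 1 : Fin n → ℂ) ∈ Submodule.span ℂ (C j)) :
    ∃ T : Matrix (Fin n) (Fin n) ℂ, T.det ≠ 0 ∧ ∀ j, (fun i => T i j) ∈ C j := by
  suffices h : ∀ s : Finset (Fin n), ∃ T : Matrix (Fin n) (Fin n) ℂ, T.det ≠ 0 ∧
      (∀ j ∈ s, (fun i => T i j) ∈ C j) ∧
      ∀ j ∉ s, (fun i => T i j) = Pi.single j 1 by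
    obtain ⟨T, h1, h2, -⟩ := h Finset.univ
    exact ⟨T, h1, fun j => h2 j (Finset.mem_univ j)⟩
  intro s
  induction s using Finset.induction_on with
  | empty =>
    refine ⟨1, by simp, by simp, fun j _ => ?_⟩
    ext i
    simp [Matrix.one_apply, Pi.single_apply]
  | insert a s ha ih =>
    obtain ⟨T, h1, h2, h3⟩ := ih
    have key : ∃ v ∈ C a, (T.updateCol a v).det ≠ 0 := by
      by_contra! hcon
      have hle : Submodule.span ℂ (C a) ≤
          LinearMap.ker ((LinearMap.proj a).comp (Matrix.cramer T)) := by
        rw [Submodule.span_le]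
        intro v hv
        simpa [Matrix.cramer_apply] using hcon v hv
      have h4 := hle (hC a)
      rw [← h3 a ha] at h4
      simp only [LinearMap.mem_ker, LinearMap.comp_apply, LinearMap.proj_apply,
        Matrix.cramer_apply] at h4
      apply h1
      rw [← h4]
      congr 1
      ext i j
      by_cases hj : j = a
      · subst hj; simp
      · simp [hj]
    obtain ⟨v, hv, hdet⟩ := key
    refine ⟨T.updateCol a v, hdet, ?_, ?_⟩
    · intro j hj
      by_cases hja : j = a
      · subst hja; simpa using hv
      · have := h2 j ((Finset.mem_insert.1 hj).resolve_left hja)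
        simpa [Matrix.updateCol_ne hja] using this
    · intro j hj
      have hja : j ≠ a := fun h => hj (h ▸ Finset.mem_insert_self a s)
      have := h3 j (fun h => hj (Finset.mem_insert_of_mem h))
      simpa [Matrix.updateCol_ne hja] using this

/-- Vectors supported on the indices below `j`. -/
def lowerSupp {n : ℕ} (ρ : Fin n → Fin n → Prop) (j : Fin n) : Submodule ℂ (Fin n → ℂ) where
  carrier := {v | ∀ i, ¬ ρ i j → v i = 0}
  add_mem' := by
    intro a b ha hb i hi
    simp [ha i hi, hb i hi]
  zero_mem' := by intro i _; rfl
  smul_mem' := by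
    intro c x hx i hi
    simp [hx i hi]

lemma mulVec_mem_lowerSupp {n : ℕ} {ρ : Fin n → Fin n → Prop}
    (htrans : ∀ i j k, ρ i j → ρ j k → ρ i k) {X : Matrix (Fin n) (Fin n) ℂ}
    (hX : X ∈ structuralMatrixAlgebra ρ) (j : Fin n) {v : Fin n → ℂ} (hv : v ∈ lowerSupp ρ j) :
    X.mulVec v ∈ lowerSupp ρ j := by
  intro i hi
  change ∑ k, X i k * v k = 0
  refine Finset.sum_eq_zero fun k _ => ?_
  by_cases hik : ρ i k
  · rw [hv k (fun hkj => hi (htrans i k j hik hkj)), mul_zero]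
  · rw [hX i k hik, zero_mul]

/-- The inverse of an invertible matrix in a structural matrix algebra is in the algebra. -/
lemma inv_mem_sma {n : ℕ} {ρ : Fin n → Fin n → Prop}
    (hrefl : ∀ i, ρ i i) (htrans : ∀ i j k, ρ i j → ρ j k → ρ i k)
    {T : Matrix (Fin n) (Fin n) ℂ} (hT : T ∈ structuralMatrixAlgebra ρ) (hdet : T.det ≠ 0) :
    T⁻¹ ∈ structuralMatrixAlgebra ρ := by
  have hu : IsUnit T.det := isUnit_iff_ne_zero.2 hdet
  intro i j hij
  let f : lowerSupp ρ j →ₗ[ℂ] lowerSupp ρ j :=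
    (Matrix.toLin' T).restrict (fun v hv => mulVec_mem_lowerSupp htrans hT j hv)
  have hinj : Function.Injective f := by
    intro x y hxy
    have h1 : T.mulVec x.1 = T.mulVec y.1 := congrArg Subtype.val hxy
    have := congrArg (fun w => T⁻¹.mulVec w) h1
    simp only [Matrix.mulVec_mulVec, Matrix.nonsing_inv_mul T hu, Matrix.one_mulVec] at this
    exact Subtype.ext this
  have hsurj := LinearMap.injective_iff_surjective.1 hinj
  obtain ⟨y, hy⟩ := hsurj ⟨Pi.single j 1, fun i hi => by
    rw [Pi.single_eq_of_ne]
    rintro rfl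
    exact hi (hrefl i)⟩
  have h1 : T.mulVec y.1 = Pi.single j 1 := congrArg Subtype.val hy
  have h2 := congrArg (fun w => T⁻¹.mulVec w) h1
  simp only [Matrix.mulVec_mulVec, Matrix.nonsing_inv_mul T hu, Matrix.one_mulVec,
    Matrix.mulVec_single_one] at h2
  have h3 := congrFun h2 i
  rw [y.2 i hij] at h3
  exact h3.symm

/-- The standard basis vector is a sum of joint eigenvectors with support below `j`. -/
lemma single_mem_span_joint {n : ℕ} (ρ : Fin n → Fin n → Prop)
    (hrefl : ∀ i, ρ i i) (htrans : ∀ i j k, ρ i j → ρ j k → ρ i k)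
    (F : Set (Matrix (Fin n) (Fin n) ℂ))
    (hFA : F ⊆ structuralMatrixAlgebra ρ)
    (hcomm : ∀ X ∈ F, ∀ Y ∈ F, X * Y = Y * X)
    (hdiag : ∀ X ∈ F, ∃ P : Matrix (Fin n) (Fin n) ℂ,
      IsUnit P ∧ (P * X * P⁻¹).IsDiag) (j : Fin n) :
    (Pi.single j 1 : Fin n → ℂ) ∈ Submodule.span ℂ
      {v | v ∈ lowerSupp ρ j ∧ ∀ X ∈ F, ∃ μ : ℂ, X.mulVec v = μ • v} := by
  let f : F → Module.End ℂ (lowerSupp ρ j) := fun X =>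
    (Matrix.toLin' X.1).restrict (fun v hv => mulVec_mem_lowerSupp htrans (hFA X.2) j hv)
  have hf : ∀ X v, (f X v).1 = X.1.mulVec v.1 := fun X v => rfl
  have htop := Module.End.iSup_iInf_maxGenEigenspace_eq_top_of_iSup_maxGenEigenspace_eq_top_of_commute
    f (fun X Y _ => by
      apply LinearMap.ext
      intro v
      apply Subtype.ext
      rw [Module.End.mul_apply, Module.End.mul_apply, hf, hf, hf, hf, Matrix.mulVec_mulVec,
        Matrix.mulVec_mulVec, hcomm X.1 X.2 Y.1 Y.2])
    (fun X => Module.End.iSup_maxGenEigenspace_eq_top (f X))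
  have hle : (⨆ χ : F → ℂ, ⨅ X, (f X).maxGenEigenspace (χ X)) ≤
      (Submodule.span ℂ {v | v ∈ lowerSupp ρ j ∧ ∀ X ∈ F, ∃ μ : ℂ, X.mulVec v = μ • v}).comap
        (lowerSupp ρ j).subtype := by
    refine iSup_le fun χ v hv => ?_
    refine Submodule.subset_span ⟨v.2, fun X hX => ⟨χ ⟨X, hX⟩, ?_⟩⟩
    obtain ⟨P, hP, hD⟩ := hdiag X hX
    have h1 := (Submodule.mem_iInf _).1 hv ⟨X, hX⟩
    obtain ⟨k, hk⟩ := (Module.End.mem_maxGenEigenspace _ _ _).1 h1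
    refine diagonalizable_gen_eigen X P hP hD _ k v.1 ?_
    have hpow : ∀ (k : ℕ) (w : lowerSupp ρ j),
        (((f ⟨X, hX⟩ - χ ⟨X, hX⟩ • 1) ^ k) w).1 =
        ((X - χ ⟨X, hX⟩ • (1 : Matrix (Fin n) (Fin n) ℂ)) ^ k).mulVec w.1 := by
      intro k
      induction k with
      | zero => intro w; simp
      | succ k ih =>
        intro w
        rw [pow_succ, pow_succ, Module.End.mul_apply, ih, ← Matrix.mulVec_mulVec]
        congr 1
        rw [Matrix.sub_mulVec, Matrix.smul_mulVec, Matrix.one_mulVec]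
        rfl
    rw [← hpow, hk]
    rfl
  rw [htop] at hle
  exact hle (x := ⟨Pi.single j 1, fun i hi => by
    rw [Pi.single_eq_of_ne]
    rintro rfl
    exact hi (hrefl i)⟩) Submodule.mem_top

/-- Any commuting family of diagonalizable matrices in a structural
matrix algebra `A_ρ` can be simultaneously diagonalized by an invertible matrix
`S` belonging to `A_ρ` (with `S⁻¹ ∈ A_ρ`). -/
theorem sma_simultaneous_diagonalization {n : ℕ} (ρ : Fin n → Fin n → Prop)
    (hrefl : ∀ i, ρ i i) (htrans : ∀ i j k, ρ i j → ρ j k → ρ i k)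
    (F : Set (Matrix (Fin n) (Fin n) ℂ))
    (hFA : F ⊆ structuralMatrixAlgebra ρ)
    (hcomm : ∀ X ∈ F, ∀ Y ∈ F, X * Y = Y * X)
    (hdiag : ∀ X ∈ F, ∃ P : Matrix (Fin n) (Fin n) ℂ,
      IsUnit P ∧ (P * X * P⁻¹).IsDiag) :
    ∃ S : Matrix (Fin n) (Fin n) ℂ, IsUnit S ∧
      S ∈ structuralMatrixAlgebra ρ ∧ S⁻¹ ∈ structuralMatrixAlgebra ρ ∧
      ∀ X ∈ F, (S * X * S⁻¹).IsDiag := by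
  obtain ⟨T, hdet, hT⟩ := exists_choice_det_ne_zero _
    (single_mem_span_joint ρ hrefl htrans F hFA hcomm hdiag)
  have hu : IsUnit T.det := isUnit_iff_ne_zero.2 hdet
  have hTA : T ∈ structuralMatrixAlgebra ρ := fun i j hij => (hT j).1 i hij
  have hii : T⁻¹⁻¹ = T := Matrix.nonsing_inv_nonsing_inv T hu
  refine ⟨T⁻¹, ?_, inv_mem_sma hrefl htrans hTA hdet, by rwa [hii], ?_⟩
  · exact (Matrix.isUnit_iff_isUnit_det _).2 (Matrix.isUnit_nonsing_inv_det T hu)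
  · intro X hX
    choose d hd using fun j => (hT j).2 X hX
    have h1 : X * T = T * Matrix.diagonal d := by
      ext i j
      rw [Matrix.mul_diagonal]
      have := congrFun (hd j) i
      rw [Pi.smul_apply, smul_eq_mul, mul_comm] at this
      exact this
    rw [hii, Matrix.mul_assoc, h1, ← Matrix.mul_assoc, Matrix.nonsing_inv_mul T hu,
      Matrix.one_mul]
    exact Matrix.isDiag_diagonal d
end

section
/- Let A_ρ ⊆ M_n(ℂ) be a structural matrix algebra and let φ : A_ρ → M_n(ℂ) be an injective map satisfying φ(X ∘ Y) = φ(X) ∘ φ(Y) for all X, Y ∈ A_ρ, where ∘ is the normalized Jordan product. Then for all idempotents P, Q ∈ A_ρ, P ⊥ Q implies φ(P) ⊥ φ(Q). -/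
/-- The normalized Jordan product `X ∘ Y = (1/2)(XY + YX)`. -/
noncomputable def njord {n : ℕ} (X Y : Matrix (Fin n) (Fin n) ℂ) : Matrix (Fin n) (Fin n) ℂ :=
  (1 / 2 : ℂ) • (X * Y + Y * X)

theorem aux_orth {n : ℕ} {p q : Matrix (Fin n) (Fin n) ℂ} (hp : p * p = p)
    (h : p * q + q * p = 0) : p * q = 0 ∧ q * p = 0 := by
  have h1 : p * q + p * q * p = 0 := by
    have := congrArg (fun x => p * x) h
    simpa [mul_add, ← mul_assoc, hp] using this
  have h2 : p * q * p + q * p = 0 := by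
    have := congrArg (fun x => x * p) h
    simpa [add_mul, mul_assoc, hp] using this
  have h3 : p * q = q * p := by
    have : p * q + p * q * p = q * p + p * q * p := by rw [h1, add_comm, h2]
    exact add_right_cancel this
  rw [← h3] at h ⊢
  have : (2 : ℂ) • (p * q) = 0 := by rw [two_smul]; exact h
  have := (smul_eq_zero.mp this).resolve_left two_ne_zero
  exact ⟨this, this⟩

theorem aux_count {n : ℕ} (F : Option (Fin n) → Matrix (Fin n) (Fin n) ℂ)
    (hid : ∀ i, F i * F i = F i) (horth : ∀ i j, i ≠ j → F i * F j = 0)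
    (hne : ∀ i, F i ≠ 0) : False := by
  have hv : ∀ i, ∃ v, (F i).mulVec v ≠ 0 := by
    intro i
    by_contra! hc
    apply hne i
    ext a b
    have := congrFun (hc (Pi.single b 1)) a
    simpa using this
  choose v hv using hv
  have hli : LinearIndependent ℂ (fun i => (F i).mulVec (v i)) := by
    rw [Fintype.linearIndependent_iff]
    intro g hg j
    have h1 := congrArg (fun x => (F j).mulVec x) hg
    simp only [Matrix.mulVec_sum, Matrix.mulVec_smul, Matrix.mulVec_mulVec,
      Matrix.mulVec_zero] at h1
    rw [Finset.sum_eq_single j] at h1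
    · rw [hid] at h1
      exact (smul_eq_zero.mp h1).resolve_right (hv j)
    · intro b _ hb
      rw [horth j b hb.symm]
      simp
    · simp
  have := hli.fintype_card_le_finrank
  simp at this

/-- An injective map on a structural matrix algebra preserving the
normalized Jordan product preserves orthogonality of idempotents
(`P ⊥ Q` meaning `PQ = QP = 0`). -/
theorem jordan_mult_map_preserves_orthogonality {n : ℕ} (ρ : Fin n → Fin n → Prop)
    (hrefl : ∀ i, ρ i i) (htrans : ∀ i j k, ρ i j → ρ j k → ρ i k)
    (φ : Matrix (Fin n) (Fin n) ℂ → Matrix (Fin n) (Fin n) ℂ)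
    (hinj : Set.InjOn φ (structuralMatrixAlgebra ρ))
    (hjord : ∀ X ∈ structuralMatrixAlgebra ρ, ∀ Y ∈ structuralMatrixAlgebra ρ,
      φ (njord X Y) = njord (φ X) (φ Y)) :
    ∀ P ∈ structuralMatrixAlgebra ρ, ∀ Q ∈ structuralMatrixAlgebra ρ,
      P * P = P → Q * Q = Q → (P * Q = 0 ∧ Q * P = 0) →
      (φ P * φ Q = 0 ∧ φ Q * φ P = 0) := by
  have hsq : ∀ X : Matrix (Fin n) (Fin n) ℂ, njord X X = X * X := by
    intro X
    unfold njord
    rw [← two_smul ℂ, smul_smul]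
    norm_num
  have h0 : (0 : Matrix (Fin n) (Fin n) ℂ) ∈ structuralMatrixAlgebra ρ := by
    intro i j _; rfl
  have hidem : ∀ X ∈ structuralMatrixAlgebra ρ, X * X = X → φ X * φ X = φ X := by
    intro X hX h
    have := hjord X hX X hX
    rw [hsq, hsq, h] at this
    exact this.symm
  have hE : φ 0 * φ 0 = φ 0 := hidem 0 h0 (by simp)
  have hdouble : ∀ X Y : Matrix (Fin n) (Fin n) ℂ, X * Y + Y * X = njord X Y + njord X Y := by
    intro X Y
    unfold njord
    rw [← two_smul ℂ, smul_smul]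
    norm_num
  have hEX : ∀ X ∈ structuralMatrixAlgebra ρ, φ 0 * φ X = φ 0 ∧ φ X * φ 0 = φ 0 := by
    intro X hX
    have h1 : φ 0 * φ X + φ X * φ 0 = φ 0 + φ 0 := by
      rw [hdouble, ← hjord 0 h0 X hX]
      simp [njord]
    have h2 := aux_orth (p := φ 0) (q := φ X - φ 0) hE (by
      rw [mul_sub, sub_mul, hE]
      have : φ 0 * φ X - φ 0 + (φ X * φ 0 - φ 0)
        = (φ 0 * φ X + φ X * φ 0) - (φ 0 + φ 0) := by abel
      rw [this, h1, sub_self])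
    rw [mul_sub, sub_mul, hE, sub_eq_zero, sub_eq_zero] at h2
    exact h2
  have hsub : ∀ X ∈ structuralMatrixAlgebra ρ, X * X = X →
      (φ X - φ 0) * (φ X - φ 0) = φ X - φ 0 := by
    intro X hX h
    rw [sub_mul, mul_sub, mul_sub, hidem X hX h, (hEX X hX).1, (hEX X hX).2, hE]
    abel
  have horth : ∀ P ∈ structuralMatrixAlgebra ρ, ∀ Q ∈ structuralMatrixAlgebra ρ,
      P * P = P → P * Q = 0 → Q * P = 0 → (φ P - φ 0) * (φ Q - φ 0) = 0 ∧
        (φ Q - φ 0) * (φ P - φ 0) = 0 := by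
    intro P hP Q hQ hPP hPQ hQP
    apply aux_orth (hsub P hP hPP)
    have h1 : φ P * φ Q + φ Q * φ P = φ 0 + φ 0 := by
      rw [hdouble, ← hjord P hP Q hQ]
      simp [njord, hPQ, hQP]
    simp only [sub_mul, mul_sub, (hEX P hP).1, (hEX P hP).2, (hEX Q hQ).1, (hEX Q hQ).2, hE]
    have : φ P * φ Q - φ 0 - (φ 0 - φ 0) + (φ Q * φ P - φ 0 - (φ 0 - φ 0))
      = (φ P * φ Q + φ Q * φ P) - (φ 0 + φ 0) := by abel
    rw [this, h1, sub_self]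
  have hz : φ 0 = 0 := by
    by_contra hne
    have hmem : ∀ i : Fin n, Matrix.single i i (1 : ℂ) ∈ structuralMatrixAlgebra ρ := by
      intro i a b hab
      apply Matrix.single_apply_of_ne
      rintro ⟨rfl, rfl⟩
      exact hab (hrefl _)
    have hss : ∀ i : Fin n, Matrix.single i i (1 : ℂ) * Matrix.single i i (1 : ℂ)
        = Matrix.single i i (1 : ℂ) := by
      intro i; simp
    apply aux_count (n := n) (fun o => o.elim (φ 0) (fun i => φ (Matrix.single i i 1) - φ 0))
    · rintro (_ | i)
      · exact hE
      · exact hsub _ (hmem i) (hss i)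
    · rintro (_ | i) (_ | j) hij
      · exact absurd rfl hij
      · simp [mul_sub, (hEX _ (hmem j)).1, hE]
      · simp [sub_mul, (hEX _ (hmem i)).2, hE]
      · have hij' : i ≠ j := fun h => hij (by rw [h])
        exact (horth _ (hmem i) _ (hmem j) (hss i)
          (by simp [Matrix.single_mul_single_of_ne, hij'])
          (by simp [Matrix.single_mul_single_of_ne, hij'.symm])).1
    · rintro (_ | i)
      · exact hne
      · intro h
        have h1 := hinj (hmem i) h0 (sub_eq_zero.mp h)
        have := congrFun (congrFun h1 i) i
        simp at this
  intro P hP Q hQ hPP _ hPQ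
  have := horth P hP Q hQ hPP hPQ.1 hPQ.2
  simpa [hz] using this
end

section
/- Let A_ρ ⊆ M_n(ℂ) be a structural matrix algebra such that every central class of A_ρ has at least 2 elements. Then every injective map φ : A_ρ → M_n(ℂ) satisfying φ(XY + YX) = φ(X)φ(Y) + φ(Y)φ(X) for all X, Y ∈ A_ρ is additive. -/
/-- The equivalence relation `≈` whose classes are the central classes of `A_ρ`:
the reflexive-transitive closure of `i ≈₀ j ⟺ (i,j) ∈ ρ ∨ (j,i) ∈ ρ`. -/
def centralRel {n : ℕ} (ρ : Fin n → Fin n → Prop) : Fin n → Fin n → Prop :=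
  Relation.ReflTransGen (fun a b => ρ a b ∨ ρ b a)

open Matrix in
lemma exists_conj {n : ℕ} (e : Fin n → Matrix (Fin n) (Fin n) ℂ)
    (hid : ∀ i, e i * e i = e i) (hne : ∀ i, e i ≠ 0)
    (hor : ∀ i j, i ≠ j → e i * e j = 0) :
    ∃ P P' : Matrix (Fin n) (Fin n) ℂ, P' * P = 1 ∧ P * P' = 1 ∧
      ∀ i, P' * e i * P = diagonal (Pi.single i 1) := by
  have hv : ∀ i, ∃ v : Fin n → ℂ, v ≠ 0 ∧ e i *ᵥ v = v := by
    intro i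
    obtain ⟨w, hw⟩ : ∃ w, e i *ᵥ w ≠ 0 := by
      by_contra! h
      apply hne i
      ext a b
      have := congrFun (h (Pi.single b 1)) a
      simpa using this
    exact ⟨e i *ᵥ w, hw, by rw [mulVec_mulVec, hid]⟩
  choose v hv0 hv1 using hv
  have hvo : ∀ i j, i ≠ j → e i *ᵥ v j = 0 := by
    intro i j hij
    rw [← hv1 j, mulVec_mulVec, hor i j hij, zero_mulVec]
  let P : Matrix (Fin n) (Fin n) ℂ := (Matrix.of v)ᵀ
  have hPc : ∀ j, P.col j = v j := fun j => rfl
  have hinj : Function.Injective P.mulVec := by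
    rw [mulVec_injective_iff]
    rw [Fintype.linearIndependent_iff]
    intro g hg i
    have h2 : e i *ᵥ (∑ j, g j • P.col j) = g i • v i := by
      rw [mulVec_sum]
      rw [Finset.sum_eq_single i]
      · rw [mulVec_smul, hPc, hv1]
      · intro b _ hb
        rw [mulVec_smul, hPc, hvo i b hb.symm, smul_zero]
      · simp
    rw [hg, mulVec_zero] at h2
    rcases smul_eq_zero.1 h2.symm with h | h
    · exact h
    · exact absurd h (hv0 i)
  have hu : IsUnit P := mulVec_injective_iff_isUnit.1 hinj
  have hd : IsUnit P.det := (isUnit_iff_isUnit_det P).1 hu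
  refine ⟨P, P⁻¹, nonsing_inv_mul P hd, mul_nonsing_inv P hd, ?_⟩
  intro i
  have : e i * P = P * diagonal (Pi.single i 1) := by
    ext a b
    rw [mul_diagonal]
    have h : (e i * P) a b = (e i *ᵥ v b) a := rfl
    rw [h]
    by_cases hb : b = i
    · subst hb
      rw [hv1]; simp [P]
    · rw [hvo i b (Ne.symm hb)]; simp [hb]
  rw [mul_assoc, this, ← mul_assoc, nonsing_inv_mul P hd, one_mul]

open Matrix in
lemma normalized_additive {n : ℕ} (ρ : Fin n → Fin n → Prop)
    (hrefl : ∀ i, ρ i i)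
    (hnb : ∀ i : Fin n, ∃ j, j ≠ i ∧ (ρ i j ∨ ρ j i))
    (φ : Matrix (Fin n) (Fin n) ℂ → Matrix (Fin n) (Fin n) ℂ)
    (hinj : Set.InjOn φ (structuralMatrixAlgebra ρ))
    (hcl : ∀ X ∈ structuralMatrixAlgebra ρ, ∀ Y ∈ structuralMatrixAlgebra ρ,
      X * Y + Y * X ∈ structuralMatrixAlgebra ρ)
    (hjord : ∀ X ∈ structuralMatrixAlgebra ρ, ∀ Y ∈ structuralMatrixAlgebra ρ,
      φ (X * Y + Y * X) = φ X * φ Y + φ Y * φ X)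
    (h0 : φ 0 = 0)
    (hE : ∀ i, φ (diagonal (Pi.single i (1/2))) = diagonal (Pi.single i (1/2))) :
    ∀ X ∈ structuralMatrixAlgebra ρ, ∀ Y ∈ structuralMatrixAlgebra ρ,
      φ (X + Y) = φ X + φ Y := by
  have hdm : ∀ d : Fin n → ℂ, diagonal d ∈ structuralMatrixAlgebra ρ := by
    intro d i j hij
    rw [diagonal_apply_ne]
    rintro rfl
    exact hij (hrefl i)
  have hsm : ∀ i j x, ρ i j → single i j x ∈ structuralMatrixAlgebra ρ := by
    intro i j x hij k l hkl
    rw [single_apply, if_neg]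
    rintro ⟨rfl, rfl⟩
    exact hkl hij
  have h0m : (0 : Matrix (Fin n) (Fin n) ℂ) ∈ structuralMatrixAlgebra ρ := fun _ _ _ => rfl
  -- Jordan multiplication by a half idempotent
  have hB1 : ∀ X ∈ structuralMatrixAlgebra ρ, ∀ i k l,
      φ (diagonal (Pi.single i (1/2)) * X + X * diagonal (Pi.single i (1/2))) k l
        = ((Pi.single i (1/2) : Fin n → ℂ) k + (Pi.single i (1/2) : Fin n → ℂ) l) * φ X k l := by
    intro X hX i k l
    rw [hjord _ (hdm _) _ hX, hE]
    simp only [Matrix.add_apply, diagonal_mul, mul_diagonal]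
    ring
  let f : Fin n → ℂ → ℂ := fun i x => φ (diagonal (Pi.single i x)) i i
  have hB2 : ∀ d, φ (diagonal d) = diagonal (fun i => f i (d i)) := by
    intro d
    ext a b
    by_cases hab : a = b
    · subst hab
      have h := hB1 _ (hdm d) a a a
      rw [diagonal_apply_eq]
      have h2 : (diagonal (Pi.single a (1/2)) * diagonal d + diagonal d * diagonal (Pi.single a (1/2)))
          = (diagonal (Pi.single a (d a)) : Matrix (Fin n) (Fin n) ℂ) := by
        rw [diagonal_mul_diagonal, diagonal_mul_diagonal, diagonal_add]
        congr 1
        ext k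
        by_cases hk : k = a
        · subst hk; simp; ring
        · simp [hk]
      rw [h2] at h
      simp only [Pi.single_eq_same] at h
      show _ = φ _ a a
      rw [h]; ring
    · rw [diagonal_apply_ne _ hab]
      have h := hB1 _ (hcl _ (hdm (Pi.single a (1/2))) _ (hdm d)) b a b
      rw [hB1 _ (hdm d)] at h
      have h2 : (diagonal (Pi.single b (1/2)) * (diagonal (Pi.single a (1/2)) * diagonal d + diagonal d * diagonal (Pi.single a (1/2)))
          + (diagonal (Pi.single a (1/2)) * diagonal d + diagonal d * diagonal (Pi.single a (1/2))) * diagonal (Pi.single b (1/2)))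
          = (0 : Matrix (Fin n) (Fin n) ℂ) := by
        simp only [diagonal_mul_diagonal, diagonal_add]
        rw [← diagonal_zero]
        congr 1
        ext k
        by_cases hk : k = a
        · subst hk; simp [hab]
        · simp [hk]
      rw [h2, h0] at h
      have hba : b ≠ a := fun h => hab h.symm
      simpa [hab, hba] using h
  have hf0 : ∀ i, f i 0 = 0 := by
    intro i
    simp [f, h0]
  have hfh : ∀ i, f i (1/2) = 1/2 := by
    intro i
    simp only [f]
    rw [hE]; simp
  -- action of diagonals
  have hB3 : ∀ d, ∀ X ∈ structuralMatrixAlgebra ρ, ∀ k l,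
      φ (diagonal d * X + X * diagonal d) k l = (f k (d k) + f l (d l)) * φ X k l := by
    intro d X hX k l
    rw [hjord _ (hdm _) _ hX, hB2]
    simp only [Matrix.add_apply, diagonal_mul, mul_diagonal]
    ring
  have hB4 : ∀ (d : Fin n → ℂ) (i j : Fin n) (x : ℂ), ρ i j → ∀ k l,
      φ (single i j ((d i + d j) * x)) k l = (f k (d k) + f l (d l)) * φ (single i j x) k l := by
    intro d i j x hij k l
    rw [← hB3 d _ (hsm i j x hij)]
    congr 2
    ext a b
    simp only [Matrix.add_apply, diagonal_mul, mul_diagonal, single_apply]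
    by_cases hab : i = a ∧ j = b
    · obtain ⟨rfl, rfl⟩ := hab; simp; ring
    · simp [hab]
  have hsupp : ∀ i j x, i ≠ j → ρ i j → ∀ k l, φ (single i j x) k l ≠ 0 →
      (k = i ∧ l = j) ∨ (k = j ∧ l = i) := by
    intro i j x hij hr
    have hk : ∀ k l, φ (single i j x) k l ≠ 0 → k = i ∨ k = j := by
      intro k l h
      by_contra! hc
      have := hB4 (Pi.single k (1/2)) i j x hr k l
      by_cases hkl : l = k
      · subst hkl; simp [hc.1.symm, hc.2.symm, h0, hf0, h] at this; simp [this] at hfh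
        have := hfh l
        simp_all
      · simp [hc.1.symm, hc.2.symm, h0, hf0, h, hkl] at this
        have := hfh k
        simp_all
    have hl : ∀ k l, φ (single i j x) k l ≠ 0 → l = i ∨ l = j := by
      intro k l h
      by_contra! hc
      have := hB4 (Pi.single l (1/2)) i j x hr k l
      by_cases hkl : k = l
      · subst hkl
        rcases hk _ _ h with h1 | h1
        · exact hc.1 h1
        · exact hc.2 h1
      · simp [hc.1.symm, hc.2.symm, h0, hf0, h, hkl] at this
        have := hfh l
        simp_all
    have hii : φ (single i j x) i i = 0 := by
      have h1 := hB4 (Pi.single i (1/2)) i j x hr i i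
      have h2 := hB4 (Pi.single j (1/2)) i j x hr i i
      simp only [Pi.single_eq_same, Pi.single_eq_of_ne hij, Pi.single_eq_of_ne hij.symm, hfh, hf0, add_zero, zero_add] at h1 h2
      rw [h1] at h2
      linear_combination h2
    have hjj : φ (single i j x) j j = 0 := by
      have h1 := hB4 (Pi.single i (1/2)) i j x hr j j
      have h2 := hB4 (Pi.single j (1/2)) i j x hr j j
      simp only [Pi.single_eq_same, Pi.single_eq_of_ne hij, Pi.single_eq_of_ne hij.symm, hfh, hf0, add_zero, zero_add] at h1 h2
      rw [h1] at h2
      linear_combination -h2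
    intro k l h
    rcases hk k l h with rfl | rfl <;> rcases hl _ l h with rfl | rfl
    · exact absurd hii h
    · simp
    · simp
    · exact absurd hjj h
  -- the field maps
  have hadd' : ∀ i j, i ≠ j → ρ i j →
      (f i 1 = 1 ∧ (∀ s t, f i (s + t) = f i s + f i t)) ∧ f i = f j ∧
      (∀ t k l, φ (single i j t) k l = f i t * φ (single i j 1) k l) := by
    intro i j hij hr
    have hi : ∀ t k l, φ (single i j t) k l = f i t * φ (single i j 1) k l := by
      intro t k l
      by_cases hz : φ (single i j 1) k l = 0
      · have h1 := hB4 (Pi.single i t) i j 1 hr k l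
        simpa [hz, hij, hij.symm] using h1
      · have h1 := hB4 (Pi.single i t) i j 1 hr k l
        rcases hsupp i j 1 hij hr k l hz with ⟨rfl, rfl⟩ | ⟨rfl, rfl⟩ <;>
        simpa [hf0, hij, hij.symm] using h1
    obtain ⟨k, l, hz⟩ : ∃ k l, φ (single i j 1) k l ≠ 0 := by
      by_contra! hc
      have : φ (single i j 1) = φ 0 := by rw [h0]; ext a b; exact hc a b
      have := hinj (hsm i j 1 hr) h0m this
      have := congrFun (congrFun this i) j
      simp at this
    have hj : f i = f j := by
      funext t
      have h1 := hB4 (Pi.single j t) i j 1 hr k l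
      apply mul_right_cancel₀ hz
      rw [← hi]
      rcases hsupp i j 1 hij hr k l hz with ⟨rfl, rfl⟩ | ⟨rfl, rfl⟩ <;>
        simpa [hf0, hij, hij.symm] using h1
    refine ⟨⟨?_, ?_⟩, hj, hi⟩
    · have := hi 1 k l
      apply mul_right_cancel₀ hz
      rw [← this, one_mul]
    · intro s t
      have h1 := hB4 (Pi.single i s + Pi.single j t) i j 1 hr k l
      apply mul_right_cancel₀ hz
      rw [← hi]
      rcases hsupp i j 1 hij hr k l hz with ⟨rfl, rfl⟩ | ⟨rfl, rfl⟩
      · simpa [hf0, hij, hij.symm, hj] using h1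
      · rw [add_comm (f l s)]
        simpa [hf0, hij, hij.symm, hj] using h1
  have hfadd : ∀ i, f i 1 = 1 ∧ (∀ s t, f i (s + t) = f i s + f i t) := by
    intro i
    obtain ⟨j, hj, h | h⟩ := hnb i
    · exact (hadd' i j hj.symm h).1
    · have := hadd' j i hj h
      rw [← this.2.1]; exact this.1
  have hf1 := fun i => (hfadd i).1
  have hfa := fun i => (hfadd i).2
  have hfn : ∀ i, f i (-1) = -1 := by
    intro i
    have := hfa i 1 (-1)
    rw [add_neg_cancel, hf0, hf1] at this
    linear_combination -this
  -- diagonal entries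
  have hdiag : ∀ X ∈ structuralMatrixAlgebra ρ, ∀ i, φ X i i = f i (X i i) := by
    intro X hX i
    let D : Fin n → ℂ := fun k => if k = i then 1 else -1
    have h := hB3 (Pi.single i 1) _ (hcl _ (hdm D) _ hX) i i
    rw [hB3 _ _ hX] at h
    have h2 : diagonal (Pi.single i 1) * (diagonal D * X + X * diagonal D)
        + (diagonal D * X + X * diagonal D) * diagonal (Pi.single i 1)
        = diagonal (Pi.single i ((X i i + X i i) + (X i i + X i i))) := by
      ext a b
      simp only [Matrix.add_apply, diagonal_mul, mul_diagonal, diagonal_apply, D, Pi.single_apply]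
      by_cases ha : a = i
      · by_cases hb : b = i
        · subst ha hb; simp
        · subst ha; simp [hb, Ne.symm hb]
      · by_cases hb : b = i
        · subst hb; simp [ha]
        · simp [ha, hb]
    rw [h2] at h
    have h3 : φ (diagonal (Pi.single i ((X i i + X i i) + (X i i + X i i)))) i i
      = f i ((X i i + X i i) + (X i i + X i i)) := rfl
    rw [h3, hfa, hfa] at h
    simp only [D, if_true, Pi.single_eq_same, hf1] at h
    linear_combination -h/4
  -- pairs
  have hpair : ∀ X ∈ structuralMatrixAlgebra ρ, ∀ a b, a ≠ b →
      φ (single a b (X a b) + single b a (X b a)) a b = φ X a b := by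
    intro X hX a b hab
    have h := hB3 (Pi.single b 1) _ (hcl _ (hdm (Pi.single a 1)) _ hX) a b
    rw [hB3 _ _ hX] at h
    simp only [Pi.single_eq_same, Pi.single_eq_of_ne hab, Pi.single_eq_of_ne hab.symm, hf1, hf0,
      add_zero, zero_add, one_mul] at h
    rw [← h]
    refine congrArg (fun Z => φ Z a b) ?_
    ext k l
    simp only [Matrix.add_apply, diagonal_mul, mul_diagonal, single_apply, Pi.single_apply]
    have hba := hab.symm
    by_cases hka : k = a
    · subst hka
      by_cases hlb : l = b
      · subst hlb; simp [hab, hba]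
      · by_cases hlk : l = k
        · subst hlk; simp [hab, hba]
        · simp [hab, hba, hlb, hlk, Ne.symm hlb]
    · by_cases hkb : k = b
      · subst hkb
        by_cases hla : l = a
        · subst hla; simp [hab, hba]
        · by_cases hlk : l = k
          · subst hlk; simp [hab, hba]
          · simp [hab, hba, hla, hlk, Ne.symm hla]
      · simp [hka, hkb, Ne.symm hka, Ne.symm hkb]
        intro h1 h2
        exact absurd (h2.symm.trans h1) hab
  have hone : ∀ X ∈ structuralMatrixAlgebra ρ, ∀ a b, a ≠ b → ρ a b → 
      f a (X b a) = φ X a b * φ (single a b 1) b a + φ (single a b 1) a b * φ X b a := by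
    intro X hX a b hab hr
    have h := hdiag _ (hcl _ hX _ (hsm a b 1 hr)) a
    have h2 : (X * single a b 1 + single a b 1 * X : Matrix (Fin n) (Fin n) ℂ) a a = X b a := by
      simp [Matrix.mul_apply, single_apply, hab.symm]
    rw [h2, hjord _ hX _ (hsm a b 1 hr)] at h
    rw [← h, Matrix.add_apply, Matrix.mul_apply, Matrix.mul_apply]
    rw [Finset.sum_eq_single b, Finset.sum_eq_single b]
    · intro k _ hk
      by_cases hz : φ (single a b 1) a k = 0
      · rw [hz, zero_mul]
      · rcases hsupp a b 1 hab hr _ _ hz with h | h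
        · exact absurd h.2 hk
        · exact absurd h.1 hab
    · simp
    · intro k _ hk
      by_cases hz : φ (single a b 1) k a = 0
      · rw [hz, mul_zero]
      · rcases hsupp a b 1 hab hr _ _ hz with h | h
        · exact absurd h.2 hab
        · exact absurd h.1 hk
    · simp
  intro X hX Y hY
  have hXY : X + Y ∈ structuralMatrixAlgebra ρ := by
    intro i j hij
    rw [Matrix.add_apply, hX i j hij, hY i j hij, add_zero]
  ext a b
  rw [Matrix.add_apply]
  by_cases hab : a = b
  · subst hab
    rw [hdiag _ hX, hdiag _ hY, hdiag _ hXY, Matrix.add_apply, hfa]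
  by_cases h1 : ρ a b <;> by_cases h2 : ρ b a
  · have e1 := hone _ hX a b hab h1
    have e2 := hone _ hY a b hab h1
    have e3 := hone _ hXY a b hab h1
    have e4 := hone _ (hsm b a 1 h2) a b hab h1
    have e5 := hone _ (hsm a b 1 h1) a b hab h1
    have g1 := hone _ hX b a (Ne.symm hab) h2
    have g2 := hone _ hY b a (Ne.symm hab) h2
    have g3 := hone _ hXY b a (Ne.symm hab) h2
    have g5 := hone _ (hsm b a 1 h2) b a (Ne.symm hab) h2
    rw [Matrix.add_apply, hfa, e1, e2] at e3
    rw [Matrix.add_apply, hfa, g1, g2] at g3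
    simp only [single_apply, hab, Ne.symm hab, and_self, and_false, false_and, if_true, if_false, hf0, hf1] at e4 e5 g5
    generalize φ (single a b 1) a b = p at *
    generalize φ (single a b 1) b a = q at *
    generalize φ (single b a 1) a b = r at *
    generalize φ (single b a 1) b a = s at *
    generalize φ (X + Y) a b = u at *
    generalize φ (X + Y) b a = v at *
    generalize φ X a b = x at *
    generalize φ X b a = x' at *
    generalize φ Y a b = y at *
    generalize φ Y b a = y' at *
    have hpq : p * q = 0 := by linear_combination -e5/2
    have hrs : r * s = 0 := by linear_combination -g5/2
    rcases mul_eq_zero.1 hpq with rfl | rfl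
    · have hq : q ≠ 0 := by rintro rfl; simp at e4
      apply mul_right_cancel₀ hq
      linear_combination -e3
    · have hp : p ≠ 0 := by rintro rfl; simp at e4
      have hs : s ≠ 0 := by rintro rfl; simp at e4
      have hr : r = 0 := by simpa [hs] using hrs
      subst hr
      apply mul_right_cancel₀ hs
      linear_combination -g3
  · rw [← hpair _ hX a b hab, ← hpair _ hY a b hab, ← hpair _ hXY a b hab,
      hXY b a h2, hX b a h2, hY b a h2]
    simp only [single_zero, add_zero]
    have h := (hadd' a b hab h1).2.2
    rw [h (X a b), h (Y a b), h ((X + Y) a b), Matrix.add_apply, hfa]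
    ring
  · rw [← hpair _ hX a b hab, ← hpair _ hY a b hab, ← hpair _ hXY a b hab,
      hXY a b h1, hX a b h1, hY a b h1]
    simp only [single_zero, zero_add]
    have h := (hadd' b a (Ne.symm hab) h2).2.2
    rw [h (X b a), h (Y b a), h ((X + Y) b a), Matrix.add_apply, hfa]
    ring
  · rw [← hpair _ hX a b hab, ← hpair _ hY a b hab, ← hpair _ hXY a b hab,
      hXY a b h1, hX a b h1, hY a b h1, hXY b a h2, hX b a h2, hY b a h2]
    simp [h0]

/-- If every central class of the structural matrix algebra `A_ρ`
has at least 2 elements, then every injective map `φ : A_ρ → M_n(ℂ)` preserving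
the Jordan product `X ⋄ Y = XY + YX` is additive. -/
theorem jordan_map_additive {n : ℕ} (ρ : Fin n → Fin n → Prop)
    (hrefl : ∀ i, ρ i i) (htrans : ∀ i j k, ρ i j → ρ j k → ρ i k)
    (hclass : ∀ i : Fin n, ∃ j, j ≠ i ∧ centralRel ρ i j)
    (φ : Matrix (Fin n) (Fin n) ℂ → Matrix (Fin n) (Fin n) ℂ)
    (hinj : Set.InjOn φ (structuralMatrixAlgebra ρ))
    (hjord : ∀ X ∈ structuralMatrixAlgebra ρ, ∀ Y ∈ structuralMatrixAlgebra ρ,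
      φ (X * Y + Y * X) = φ X * φ Y + φ Y * φ X) :
    ∀ X ∈ structuralMatrixAlgebra ρ, ∀ Y ∈ structuralMatrixAlgebra ρ,
      φ (X + Y) = φ X + φ Y := by
  have hnb : ∀ i : Fin n, ∃ j, j ≠ i ∧ (ρ i j ∨ ρ j i) := by
    intro i
    obtain ⟨j, hj, h⟩ := hclass i
    by_contra! hc
    apply hj
    unfold centralRel at h
    induction h with
    | refl => rfl
    | tail _ h2 ih =>
      rename_i b c _
      by_cases hb : b = i
      · subst hb
        rcases h2 with h2 | h2
        · exact absurd h2 (hc _ hj).1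
        · exact absurd h2 (hc _ hj).2
      · exact absurd (ih hb) hb
  have hmul : ∀ X ∈ structuralMatrixAlgebra ρ, ∀ Y ∈ structuralMatrixAlgebra ρ,
      X * Y ∈ structuralMatrixAlgebra ρ := by
    intro X hX Y hY i j hij
    rw [Matrix.mul_apply]
    apply Finset.sum_eq_zero
    intro k _
    by_cases h : ρ i k
    · rw [hY k j (fun h' => hij (htrans _ _ _ h h')), mul_zero]
    · rw [hX i k h, zero_mul]
  have hcl : ∀ X ∈ structuralMatrixAlgebra ρ, ∀ Y ∈ structuralMatrixAlgebra ρ,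
      X * Y + Y * X ∈ structuralMatrixAlgebra ρ := by
    intro X hX Y hY i j hij
    rw [Matrix.add_apply, hmul X hX Y hY i j hij, hmul Y hY X hX i j hij, add_zero]
  have h0m : (0 : Matrix (Fin n) (Fin n) ℂ) ∈ structuralMatrixAlgebra ρ := fun _ _ _ => rfl
  have hdm : ∀ d : Fin n → ℂ, Matrix.diagonal d ∈ structuralMatrixAlgebra ρ := by
    intro d i j hij
    rw [Matrix.diagonal_apply_ne]
    rintro rfl
    exact hij (hrefl i)
  obtain ⟨Q, hQ⟩ : ∃ Q, Q = φ 0 + φ 0 := ⟨_, rfl⟩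
  have h0Q : φ 0 = (1/2 : ℂ) • Q := by
    rw [hQ, ← two_smul ℂ, smul_smul]; norm_num
  have hX0 : ∀ X ∈ structuralMatrixAlgebra ρ, φ X * Q + Q * φ X = Q := by
    intro X hX
    have := hjord X hX 0 h0m
    rw [mul_zero, zero_mul, add_zero] at this
    rw [hQ, mul_add]
    calc φ X * φ 0 + φ X * φ 0 + (φ 0 + φ 0) * φ X
        = (φ X * φ 0 + φ 0 * φ X) + (φ X * φ 0 + φ 0 * φ X) := by rw [add_mul]; abel
      _ = φ 0 + φ 0 := by rw [← this]
  have hQQ : Q * Q = Q := by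
    have := hX0 0 h0m
    rw [h0Q, smul_mul_assoc, mul_smul_comm, ← add_smul] at this
    norm_num at this
    exact this
  have hcomm : ∀ X ∈ structuralMatrixAlgebra ρ,
      φ X * Q = (1/2 : ℂ) • Q ∧ Q * φ X = (1/2 : ℂ) • Q := by
    intro X hX
    have h := hX0 X hX
    have h1 : Q * φ X * Q + Q * φ X = Q := by
      have := congrArg (Q * ·) h
      simp only [mul_add, ← mul_assoc, hQQ] at this
      exact this
    have h2 : φ X * Q + Q * φ X * Q = Q := by
      have := congrArg (· * Q) h
      simp only [add_mul, mul_assoc, hQQ] at this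
      rw [mul_assoc]
      exact this
    have h3 : φ X * Q = Q * φ X := by
      rw [add_comm] at h1
      exact add_right_cancel (h2.trans h1.symm)
    rw [← h3] at h ⊢
    have : φ X * Q = (1/2 : ℂ) • Q := by
      have h4 : (1/2 : ℂ) • (φ X * Q + φ X * Q) = (1/2 : ℂ) • Q := by rw [h]
      rw [← h4]
      module
    exact ⟨this, this⟩
  let E : Fin n → Matrix (Fin n) (Fin n) ℂ := fun i => Matrix.diagonal (Pi.single i (1/2))
  have hEm : ∀ i, E i ∈ structuralMatrixAlgebra ρ := fun i => hdm _
  let e : Fin n → Matrix (Fin n) (Fin n) ℂ := fun i => (2 : ℂ) • φ (E i) - Q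
  have hEE : ∀ i, φ (E i) * φ (E i) = (1/2 : ℂ) • φ (E i) := by
    intro i
    have h := hjord _ (hEm i) _ (hEm i)
    have h2 : E i * E i + E i * E i = E i := by
      simp only [E, Matrix.diagonal_mul_diagonal, Matrix.diagonal_add]
      congr 1
      ext k
      by_cases hk : k = i
      · subst hk; simp; norm_num
      · simp [hk]
    rw [h2] at h
    rw [← two_smul ℂ] at h
    nth_rewrite 3 [h]
    rw [smul_smul]; norm_num
  have hEF : ∀ i j, i ≠ j → φ (E i) * φ (E j) + φ (E j) * φ (E i) = (1/2 : ℂ) • Q := by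
    intro i j hij
    rw [← hjord _ (hEm i) _ (hEm j), ← h0Q]
    congr 1
    simp only [E, Matrix.diagonal_mul_diagonal, Matrix.diagonal_add]
    rw [← Matrix.diagonal_zero]
    congr 1
    ext k
    by_cases hk : k = i
    · subst hk; simp [hij]
    · simp [hk]
  have hid : ∀ i, e i * e i = e i := by
    intro i
    simp only [e, sub_mul, mul_sub, smul_mul_assoc, mul_smul_comm, hEE, (hcomm _ (hEm i)).1,
      (hcomm _ (hEm i)).2, hQQ]
    module
  have hne : ∀ i, e i ≠ 0 := by
    intro i h
    have h1 : φ (E i) = φ 0 := by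
      rw [h0Q, ← sub_eq_zero.1 h, smul_smul]; norm_num
    have h2 := congrFun (congrFun (hinj (hEm i) h0m h1) i) i
    simp [E] at h2
  have hor : ∀ i j, i ≠ j → e i * e j = 0 := by
    intro i j hij
    have h : e i * e j + e j * e i = 0 := by
      have h1 : e i * e j + e j * e i =
          (4 : ℂ) • (φ (E i) * φ (E j) + φ (E j) * φ (E i)) - (2 : ℂ) • Q := by
        simp only [e, sub_mul, mul_sub, smul_mul_assoc, mul_smul_comm, (hcomm _ (hEm i)).1,
          (hcomm _ (hEm i)).2, (hcomm _ (hEm j)).1, (hcomm _ (hEm j)).2, hQQ]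
        module
      rw [h1, hEF i j hij]
      module
    have h1 : e i * e j + e i * e j * e i = 0 := by
      have := congrArg (e i * ·) h
      simpa only [mul_add, ← mul_assoc, hid, mul_zero] using this
    have h2 : e i * e j * e i + e j * e i = 0 := by
      have := congrArg (· * e i) h
      simp only [add_mul, mul_assoc, hid, zero_mul] at this
      rw [mul_assoc]
      exact this
    have h3 : e i * e j = e j * e i := by
      rw [add_comm] at h1
      exact add_left_cancel (h1.trans h2.symm)
    rw [← h3, ← two_smul ℂ] at h
    simpa using h
  obtain ⟨P, P', hP1, hP2, hP⟩ := exists_conj e hid hne hor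
  have hQe : ∀ i, Q * e i = 0 := by
    intro i
    simp only [e, mul_sub, mul_smul_comm, (hcomm _ (hEm i)).2, hQQ]
    module
  have hcan : ∀ A B : Matrix (Fin n) (Fin n) ℂ, A * P * (P' * B) = A * B := by
    intro A B
    rw [mul_assoc, ← mul_assoc P, hP2, one_mul]
  have hQ0 : Q = 0 := by
    have h1 : ∀ i, P' * Q * P * Matrix.diagonal (Pi.single i 1) = 0 := by
      intro i
      rw [← hP, mul_assoc P' (e i) P, hcan, mul_assoc, ← mul_assoc Q, hQe]
      simp
    have h2 : P' * Q * P = 0 := by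
      ext a b
      have := congrFun (congrFun (h1 b) a) b
      rw [Matrix.mul_diagonal] at this
      simpa using this
    have h3 : P * (P' * Q * P) * P' = Q := by
      rw [mul_assoc P', ← mul_assoc P, hP2, one_mul, mul_assoc, hP2, mul_one]
    rw [← h3, h2]; simp
  have hback : ∀ A, P * (P' * A * P) * P' = A := by
    intro A
    rw [mul_assoc P', ← mul_assoc P, hP2, one_mul, mul_assoc, hP2, mul_one]
  have key := normalized_additive ρ hrefl hnb (fun X => P' * φ X * P) ?_ hcl ?_ ?_ ?_
  · intro X hX Y hY
    have h := key X hX Y hY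
    rw [← hback (φ (X + Y)), h, mul_add, add_mul, hback, hback]
  · intro X hX Y hY h
    simp only at h
    apply hinj hX hY
    rw [← hback (φ X), h, hback]
  · intro X hX Y hY
    have hm : ∀ A B : Matrix (Fin n) (Fin n) ℂ,
        P' * A * P * (P' * B * P) = P' * (A * B) * P := by
      intro A B
      rw [mul_assoc P' B P, hcan]
      simp only [mul_assoc]
    rw [hm, hm, hjord X hX Y hY]
    simp only [mul_add, add_mul]
  · simp [h0Q, hQ0]
  · intro i
    have h := hP i
    have h1 : φ (E i) = (1/2 : ℂ) • e i := by
      simp only [e, hQ0, sub_zero, smul_smul]; norm_num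
    show P' * φ (E i) * P = _
    rw [h1, mul_smul_comm, smul_mul_assoc, h]
    ext a b
    simp only [Matrix.smul_apply, Matrix.diagonal_apply, Pi.single_apply, smul_eq_mul]
    split_ifs <;> simp
end
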